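/- Every S-graph shift is almost sofic: for every ε > 0 there exists a subshift of finite type Y contained in X(G,S) with h(Y) ≥ h(X(G,S)) − ε. -/

import Mathlib

open Filter Topology

/-- The shift map on bi-infinite sequences over the alphabet `A`. -/
def shiftMap {A : Type*} (x : ℤ → A) : ℤ → A := fun i => x (i + 1)

/-- A finite word `w` appears (as a consecutive subsequence) in the bi-infinite
sequence `x`. -/
def Appears {A : Type*} (w : List A) (x : ℤ → A) : Prop :=
  ∃ k : ℤ, ∀ i : Fin w.length, x (k + (i : ℕ)) = w.get i

/-- `w` belongs to the language of `X`: it appears in some point of `X`. -/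
def InLanguage {A : Type*} (X : Set (ℤ → A)) (w : List A) : Prop :=
  ∃ x ∈ X, Appears w x

/-- `X` has topological entropy `h`, i.e. `(1/n) · log |B_n(X)| → h`. -/
def HasEntropy {A : Type*} (X : Set (ℤ → A)) (h : ℝ) : Prop :=
  Filter.Tendsto
    (fun n : ℕ => Real.log ({w : List A | w.length = n ∧ InLanguage X w}.ncard) / n)
    Filter.atTop (nhds h)

/-- The set of bi-infinite concatenations `⋯ u₋₁^{n₋₁} u₀^{n₀} u₁^{n₁} ⋯` with
`uᵢ ∈ V`, `nᵢ ∈ S uᵢ` and `(uᵢ, uᵢ₊₁)` an edge of the graph.  The `S`-graph shift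
`X(G,S)` is the closure of this set. -/
def SGraphCore {V : Type*} (Adj : V → V → Prop) (S : V → Set ℕ) : Set (ℤ → V) :=
  {x | ∃ (a : ℤ → V) (t : ℤ → ℤ), StrictMono t ∧
    (∀ i : ℤ, (t (i + 1) - t i).toNat ∈ S (a i)) ∧
    (∀ i : ℤ, Adj (a i) (a (i + 1))) ∧
    (∀ i k : ℤ, t i ≤ k → k < t (i + 1) → x k = a i) ∧
    (∀ m : ℤ, ∃ i : ℤ, t i ≤ m ∧ m < t (i + 1))}

/-- `X` is a subshift of finite type. -/
def IsSFT {A : Type*} (X : Set (ℤ → A)) : Prop :=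
  ∃ F : Set (List A), F.Finite ∧ X = {x | ∀ w ∈ F, ¬ Appears w x}

/-! ### Finite windows of bi-infinite sequences -/

section Windows

variable {A : Type*}

/-- The word of length `n` read in `x` from position `k` on. -/
def window (x : ℤ → A) (k : ℤ) (n : ℕ) : List A :=
  (List.range n).map fun i => x (k + (i : ℕ))

@[simp] lemma length_window (x : ℤ → A) (k : ℤ) (n : ℕ) : (window x k n).length = n := by
  simp [window]

lemma window_add (x : ℤ → A) (k : ℤ) (m n : ℕ) :
    window x k (m + n) = window x k m ++ window x (k + m) n := by
  simp [window, List.range_add, List.map_append, Function.comp_def, add_assoc]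

lemma window_eq_replicate {x : ℤ → A} {k : ℤ} {n : ℕ} {v : A}
    (h : ∀ i : ℕ, i < n → x (k + i) = v) : window x k n = List.replicate n v := by
  rw [List.eq_replicate_iff]
  refine ⟨by simp, ?_⟩
  intro b hb
  simp only [window, List.mem_map, List.mem_range] at hb
  obtain ⟨i, hi, rfl⟩ := hb
  exact h i hi

lemma appears_iff_window {w : List A} {x : ℤ → A} :
    Appears w x ↔ ∃ k, window x k w.length = w := by
  constructor
  · rintro ⟨k, hk⟩
    refine ⟨k, List.ext_getElem (by simp) fun i h₁ h₂ => ?_⟩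
    simpa [window] using hk ⟨i, h₂⟩
  · rintro ⟨k, hk⟩
    refine ⟨k, fun i => ?_⟩
    have h := List.getElem_of_eq hk (i := i) (by simp)
    simpa [window] using h

lemma appears_window (x : ℤ → A) (k : ℤ) (n : ℕ) : Appears (window x k n) x :=
  appears_iff_window.2 ⟨k, by simp⟩

lemma eq_of_window_eq {x y : ℤ → A} {k l : ℤ} {n : ℕ} (h : window x k n = window y l n)
    {i : ℕ} (hi : i < n) : x (k + i) = y (l + i) := by
  have h' := List.getElem_of_eq h (i := i) (by simpa using hi)
  simpa [window] using h'

/-- The words of length `n` in the language of `X`. -/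
def wordsOfLength (X : Set (ℤ → A)) (n : ℕ) : Set (List A) :=
  {w | w.length = n ∧ InLanguage X w}

lemma wordsOfLength_finite [Finite A] (X : Set (ℤ → A)) (n : ℕ) : (wordsOfLength X n).Finite :=
  (List.finite_length_eq A n).subset fun _ h => h.1

lemma InLanguage.mono {X Y : Set (ℤ → A)} (h : X ⊆ Y) {w : List A} (hw : InLanguage X w) :
    InLanguage Y w :=
  let ⟨x, hx, hwx⟩ := hw
  ⟨x, h hx, hwx⟩

lemma inLanguage_closure_iff [TopologicalSpace A] [DiscreteTopology A] {X : Set (ℤ → A)}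
    {w : List A} : InLanguage (closure X) w ↔ InLanguage X w := by
  refine ⟨?_, fun h => h.mono subset_closure⟩
  rintro ⟨x, hx, k, hk⟩
  have hopen : IsOpen {y : ℤ → A | ∀ i : Fin w.length, y (k + (i : ℕ)) = w.get i} := by
    simp only [Set.ofPred_forall]
    refine isOpen_iInter_of_finite fun i => ?_
    have hcont : Continuous fun y : ℤ → A => y (k + ((i : ℕ) : ℤ)) := continuous_apply _
    exact (isOpen_discrete {w.get i}).preimage hcont
  obtain ⟨y, hy, hyX⟩ := mem_closure_iff.1 hx _ hopen hk
  exact ⟨y, hyX, k, hy⟩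

lemma ncard_wordsOfLength_add_le [Finite A] (X : Set (ℤ → A)) (m n : ℕ) :
    (wordsOfLength X (m + n)).ncard ≤ (wordsOfLength X m).ncard * (wordsOfLength X n).ncard := by
  rw [← Set.ncard_prod]
  have hfin := (wordsOfLength_finite X m).prod (wordsOfLength_finite X n)
  refine (Set.ncard_le_ncard (t := (fun p : List A × List A => p.1 ++ p.2) ''
    (wordsOfLength X m ×ˢ wordsOfLength X n)) ?_ (hfin.image _)).trans (Set.ncard_image_le hfin)
  rintro w ⟨hlen, x, hx, hw⟩
  obtain ⟨k, hk⟩ := appears_iff_window.1 hw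
  rw [hlen, window_add] at hk
  exact ⟨(window x k m, window x (k + m) n),
    ⟨⟨by simp, x, hx, appears_window _ _ _⟩, ⟨by simp, x, hx, appears_window _ _ _⟩⟩, hk⟩

lemma subadditive_log_ncard [Finite A] (X : Set (ℤ → A)) :
    Subadditive fun n => Real.log ((wordsOfLength X n).ncard) := by
  intro m n
  have h := ncard_wordsOfLength_add_le X m n
  rcases Nat.eq_zero_or_pos (wordsOfLength X (m + n)).ncard with h0 | h0
  · simp only [h0, Nat.cast_zero, Real.log_zero]
    exact add_nonneg (Real.log_natCast_nonneg _) (Real.log_natCast_nonneg _)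
  · have hpos := Nat.pos_of_ne_zero (mul_ne_zero_iff.1 (h0.trans_le h).ne').1
    have hpos' := Nat.pos_of_ne_zero (mul_ne_zero_iff.1 (h0.trans_le h).ne').2
    rw [← Real.log_mul (by positivity) (by positivity)]
    exact Real.log_le_log (by exact_mod_cast h0) (by exact_mod_cast h)

lemma exists_hasEntropy [Finite A] (X : Set (ℤ → A)) : ∃ h, HasEntropy X h :=
  ⟨_, (subadditive_log_ncard X).tendsto_lim ⟨0, by
    rintro _ ⟨n, rfl⟩
    exact div_nonneg (Real.log_natCast_nonneg _) (Nat.cast_nonneg _)⟩⟩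

/-- If at least `c ^ k` words of length `k * m` occur in `X`, for every `k > 0`, then the entropy
of `X` is at least `log c / m`. -/
lemma HasEntropy.ge_of_pow_le {X : Set (ℤ → A)} {h : ℝ} (hX : HasEntropy X h) {m c : ℕ}
    (hm : 0 < m) (hc : 0 < c) (hpow : ∀ k, 0 < k → c ^ k ≤ (wordsOfLength X (k * m)).ncard) :
    Real.log c / m ≤ h := by
  have hsub : Tendsto (fun k : ℕ => k * m) atTop atTop := tendsto_id.atTop_mul_const' hm
  refine ge_of_tendsto (hX.comp hsub) ?_
  filter_upwards [eventually_gt_atTop 0] with k hk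
  have hle : Real.log ((c : ℝ) ^ k) ≤ Real.log ((wordsOfLength X (k * m)).ncard) :=
    Real.log_le_log (by positivity) (by exact_mod_cast hpow k hk)
  rw [Real.log_pow] at hle
  simp only [Function.comp_apply, Nat.cast_mul]
  rw [le_div_iff₀ (by positivity)]
  calc Real.log c / m * (k * m) = k * Real.log c := by field_simp
    _ ≤ _ := hle

end Windows

/-! ### Weights of languages -/

section Weight

variable {A : Type*}

/-- The generating function of the language `L`, evaluated at `z`. -/
noncomputable def weight (z : ENNReal) (L : Set (List A)) : ENNReal :=
  ∑' w : L, z ^ (w : List A).length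

lemma weight_mono (z : ENNReal) {L M : Set (List A)} (h : L ⊆ M) : weight z L ≤ weight z M :=
  ENNReal.tsum_mono_subtype (fun w : List A => z ^ w.length) h

lemma weight_union_le (z : ENNReal) (L M : Set (List A)) :
    weight z (L ∪ M) ≤ weight z L + weight z M :=
  ENNReal.tsum_union_le (fun w : List A => z ^ w.length) L M

lemma weight_iUnion_ne_top {ι : Type*} [Finite ι] {z : ENNReal} {L : ι → Set (List A)}
    (h : ∀ i, weight z (L i) ≠ ⊤) : weight z (⋃ i, L i) ≠ ⊤ := by
  have := Fintype.ofFinite ι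
  exact ne_top_of_le_ne_top (ENNReal.sum_ne_top.2 fun i _ => h i)
    (ENNReal.tsum_iUnion_le (fun w : List A => z ^ w.length) L)

lemma weight_image2_append_le (z : ENNReal) (L M : Set (List A)) :
    weight z (Set.image2 (· ++ ·) L M) ≤ weight z L * weight z M := by
  let f : L × M → Set.image2 (· ++ ·) L M :=
    fun p => ⟨p.1 ++ p.2, Set.mem_image2_of_mem p.1.2 p.2.2⟩
  have hf : Function.Surjective f := by
    rintro ⟨_, v, hv, w, hw, rfl⟩
    exact ⟨(⟨v, hv⟩, ⟨w, hw⟩), rfl⟩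
  refine (ENNReal.tsum_le_tsum_comp_of_surjective hf _).trans_eq ?_
  simp only [f, List.length_append, pow_add]
  rw [ENNReal.tsum_prod (f := fun (v : L) (w : M) =>
    z ^ (v : List A).length * z ^ (w : List A).length)]
  simp only [ENNReal.tsum_mul_left, ENNReal.tsum_mul_right]
  rfl

lemma weight_image2_append_ne_top {z : ENNReal} {L M : Set (List A)} (hL : weight z L ≠ ⊤)
    (hM : weight z M ≠ ⊤) : weight z (Set.image2 (· ++ ·) L M) ≠ ⊤ :=
  ne_top_of_le_ne_top (ENNReal.mul_ne_top hL hM) (weight_image2_append_le z L M)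

lemma weight_singleton_nil (z : ENNReal) : weight z {([] : List A)} = 1 := by
  simp [weight]

/-- The words that are constantly equal to `v`. -/
def constWords (v : A) : Set (List A) := Set.range fun n => List.replicate n v

lemma weight_constWords_ne_top {z : ENNReal} (hz : z < 1) (v : A) :
    weight z (constWords v) ≠ ⊤ := by
  refine ne_top_of_le_ne_top ?_ (ENNReal.tsum_le_tsum_comp_of_surjective
    (Set.rangeFactorization_surjective (f := fun n => List.replicate n v)) _)
  simp only [Set.rangeFactorization_coe, List.length_replicate, ENNReal.tsum_geometric]
  exact ENNReal.inv_ne_top.2 (tsub_pos_of_lt hz).ne'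

lemma weight_eq_of_length {z : ENNReal} {L : Set (List A)} {n : ℕ}
    (hn : ∀ w ∈ L, w.length = n) : weight z L = L.encard * z ^ n := by
  rw [weight, ← ENNReal.tsum_set_const]
  exact tsum_congr fun w => by rw [hn w w.2]

lemma weight_le_tsum (z : ENNReal) (L : Set (List A)) :
    weight z L ≤ ∑' n : ℕ, ({w ∈ L | w.length = n}.encard : ENNReal) * z ^ n := by
  have hL : L = ⋃ n : ℕ, {w ∈ L | w.length = n} := by
    ext w
    simp
  calc weight z L = weight z (⋃ n : ℕ, {w ∈ L | w.length = n}) := by rw [← hL]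
    _ ≤ ∑' n : ℕ, weight z {w ∈ L | w.length = n} :=
      ENNReal.tsum_iUnion_le_tsum (fun w : List A => z ^ w.length) _
    _ = _ := tsum_congr fun n => weight_eq_of_length fun w hw => hw.2

end Weight

/-! ### Bi-infinite concatenations -/

lemma StrictMono.exists_int_mem_Ico {t : ℤ → ℤ} (ht : StrictMono t) (m : ℤ) :
    ∃ i, t i ≤ m ∧ m < t (i + 1) := by
  have hmono : Monotone fun i => t i - i := monotone_int_of_le_succ fun i => by
    have := ht (lt_add_one i)
    omega
  obtain ⟨i, hi, hmax⟩ := Int.exists_greatest_of_bdd (P := fun i => t i ≤ m)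
    ⟨max 0 (m - t 0), fun i hi => by
      by_contra! h
      have := hmono (show 0 ≤ i by omega)
      simp only at this
      omega⟩
    ⟨min 0 (m - t 0), by
      have := hmono (show min 0 (m - t 0) ≤ 0 by omega)
      simp only at this
      omega⟩
  refine ⟨i, hi, ?_⟩
  by_contra! h
  have := hmax _ h
  omega

lemma exists_int_partialSums (n : ℤ → ℤ) : ∃ t : ℤ → ℤ, t 0 = 0 ∧ ∀ i, t (i + 1) = t i + n i := by
  refine ⟨fun i => ∑ j ∈ Finset.Ico 0 i, n j - ∑ j ∈ Finset.Ico i 0, n j, by simp, fun i => ?_⟩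
  beta_reduce
  rcases le_or_gt 0 i with hi | hi
  · rw [← Finset.insert_Ico_right_eq_Ico_add_one hi, Finset.sum_insert (by simp),
      Finset.Ico_eq_empty_of_le hi, Finset.Ico_eq_empty_of_le (by omega : (0 : ℤ) ≤ i + 1)]
    simp
    ring
  · rw [← Finset.insert_Ico_add_one_left_eq_Ico hi, Finset.sum_insert (by simp),
      Finset.Ico_eq_empty_of_le hi.le, Finset.Ico_eq_empty_of_le (by omega : i + 1 ≤ 0)]
    simp

/-- An increasing enumeration by `ℤ` of a set of integers unbounded in both directions. -/
lemma exists_strictMono_range_eq {B : Set ℤ} (hup : ∀ k, ∃ b ∈ B, k < b)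
    (hdown : ∀ k, ∃ b ∈ B, b < k) :
    ∃ t : ℤ → ℤ, StrictMono t ∧ Set.range t = B := by
  classical
  have : Nonempty B := let ⟨b, hb, _⟩ := hup 0; ⟨⟨b, hb⟩⟩
  have : NoMaxOrder B := ⟨fun a => let ⟨b, hb, h⟩ := hup a; ⟨⟨b, hb⟩, h⟩⟩
  have : NoMinOrder B := ⟨fun a => let ⟨b, hb, h⟩ := hdown a; ⟨⟨b, hb⟩, h⟩⟩
  let : LocallyFiniteOrder B := Subtype.instLocallyFiniteOrder (· ∈ B)
  let : SuccOrder B := LinearLocallyFiniteOrder.succOrder B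
  let : PredOrder B := LinearLocallyFiniteOrder.predOrder B
  let e : B ≃o ℤ := orderIsoIntOfLinearSuccPredArch
  refine ⟨fun i => e.symm i, fun i j h => e.symm.strictMono h, ?_⟩
  ext b
  constructor
  · rintro ⟨i, rfl⟩
    exact (e.symm i).2
  · exact fun hb => ⟨e ⟨b, hb⟩, by simp⟩

section Core

variable {V : Type*} {Adj : V → V → Prop} {S T : V → Set ℕ}

lemma SGraphCore_mono (h : ∀ v, S v ⊆ T v) : SGraphCore Adj S ⊆ SGraphCore Adj T := by
  rintro x ⟨a, t, ht, hS, hx⟩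
  exact ⟨a, t, ht, fun i => h _ (hS i), hx⟩

/-- Any admissible bi-infinite sequence of blocks is realised by a point of the core. -/
lemma exists_mem_SGraphCore (hPos : ∀ v, 0 ∉ S v) {a : ℤ → V} {n : ℤ → ℕ}
    (hn : ∀ i, n i ∈ S (a i)) (ha : ∀ i, Adj (a i) (a (i + 1))) :
    ∃ x ∈ SGraphCore Adj S, ∃ t : ℤ → ℤ, (∀ i, t (i + 1) = t i + n i) ∧
      ∀ i k, t i ≤ k → k < t (i + 1) → x k = a i := by
  obtain ⟨t, -, ht⟩ := exists_int_partialSums fun i => n i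
  have hmono : StrictMono t := strictMono_int_of_lt_succ fun i => by
    have : n i ≠ 0 := fun h => hPos _ (h ▸ hn i)
    have := ht i
    omega
  choose j hj hj' using hmono.exists_int_mem_Ico
  have hx : ∀ i k, t i ≤ k → k < t (i + 1) → a (j k) = a i := fun i k hi hi' => by
    have h₁ : i < j k + 1 := hmono.lt_iff_lt.1 (hi.trans_lt (hj' k))
    have h₂ : j k < i + 1 := hmono.lt_iff_lt.1 ((hj k).trans_lt hi')
    rw [show j k = i by omega]
  refine ⟨fun k => a (j k), ⟨a, t, hmono, fun i => ?_, ha, hx, hmono.exists_int_mem_Ico⟩, t, ht, hx⟩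
  rw [ht]
  simpa using hn i

lemma SGraphCore.exists_ne (hLoop : ∀ v, ¬ Adj v v) {N : ℕ} (hN : ∀ v, ∀ n ∈ S v, n ≤ N)
    {x : ℤ → V} (hx : x ∈ SGraphCore Adj S) (k : ℤ) :
    ∃ i : ℕ, 0 < i ∧ i ≤ N ∧ x (k + i) ≠ x k := by
  obtain ⟨a, t, ht, hS, hadj, hconst, hcover⟩ := hx
  obtain ⟨i, hi, hi'⟩ := hcover k
  have hle := hN _ _ (hS i)
  refine ⟨(t (i + 1) - k).toNat, by omega, by omega, ?_⟩
  rw [hconst i k hi hi', hconst (i + 1) _ (by omega)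
    (by have := ht (lt_add_one (i + 1)); omega)]
  exact fun h => hLoop (a i) (by simpa [h] using hadj i)

lemma SGraphCore.adj_and_exists_block (hLoop : ∀ v, ¬ Adj v v) {x : ℤ → V}
    (hx : x ∈ SGraphCore Adj S) {k : ℤ} (hk : x k ≠ x (k + 1)) :
    Adj (x k) (x (k + 1)) ∧ ∃ n ∈ S (x (k + 1)),
      (∀ j : ℕ, 0 < j → j ≤ n → x (k + j) = x (k + 1)) ∧ x (k + (n + 1 : ℕ)) ≠ x (k + 1) := by
  obtain ⟨a, t, ht, hS, hadj, hconst, hcover⟩ := hx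
  obtain ⟨i, hi, hi'⟩ := hcover k
  have hnext : t (i + 1) = k + 1 := by
    by_contra h
    exact hk (by rw [hconst i k hi hi', hconst i (k + 1) (by omega) (by omega)])
  have h₁ := ht (lt_add_one (i + 1))
  have h₂ := ht (lt_add_one (i + 1 + 1))
  have hk₁ : x (k + 1) = a (i + 1) := hconst (i + 1) _ (by omega) (by omega)
  rw [hk₁, hconst i k hi hi']
  refine ⟨hadj i, _, hS (i + 1), fun j hj hj' => hconst (i + 1) _ (by omega) (by omega), ?_⟩
  rw [hconst (i + 1 + 1) _ (by omega) (by omega)]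
  exact fun h => hLoop (a (i + 1)) (by simpa [h] using hadj (i + 1))

/-- A point lies in the core as soon as its maximal runs are bounded, have admissible lengths and
are joined by edges. -/
lemma mem_SGraphCore_of_runs (hPos : ∀ v, 0 ∉ S v) {N : ℕ} {x : ℤ → V}
    (hne : ∀ k : ℤ, ∃ i : ℕ, 0 < i ∧ i ≤ N ∧ x (k + i) ≠ x k)
    (hrun : ∀ k : ℤ, x k ≠ x (k + 1) → Adj (x k) (x (k + 1)) ∧ ∃ n ∈ S (x (k + 1)),
      (∀ j : ℕ, 0 < j → j ≤ n → x (k + j) = x (k + 1)) ∧ x (k + (n + 1 : ℕ)) ≠ x (k + 1)) :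
    x ∈ SGraphCore Adj S := by
  have hchange : ∀ k : ℤ, ∃ i : ℕ, i < N ∧ x (k + i) ≠ x (k + i + 1) := fun k => by
    by_contra! h
    obtain ⟨i, -, hiN, hi⟩ := hne k
    refine hi ?_
    clear hi
    induction i with
    | zero => simp
    | succ i ih =>
      rw [← ih (by omega), h i (by omega)]
      push_cast
      rw [add_assoc]
  obtain ⟨t, ht, hrange⟩ := exists_strictMono_range_eq (B := {k | x (k - 1) ≠ x k})
    (fun k => by
      obtain ⟨i, -, hi⟩ := hchange k
      exact ⟨k + i + 1, by simpa using hi, by omega⟩)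
    (fun k => by
      obtain ⟨i, hiN, hi⟩ := hchange (k - N - 1)
      exact ⟨k - N - 1 + i + 1, by simpa using hi, by omega⟩)
  have hmem : ∀ i, x (t i - 1) ≠ x (t i) := fun i => by
    have h : t i ∈ {k | x (k - 1) ≠ x k} := hrange ▸ Set.mem_range_self i
    exact h
  have hblock : ∀ i, ∃ n ∈ S (x (t i)), t (i + 1) = t i + n ∧
      ∀ k, t i ≤ k → k < t i + n → x k = x (t i) := fun i => by
    obtain ⟨-, n, hn, hconst, hend⟩ := hrun (t i - 1) (by simpa using hmem i)
    rw [sub_add_cancel] at hn hconst hend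
    have hn0 : n ≠ 0 := fun h => hPos _ (h ▸ hn)
    have hconst' : ∀ k, t i ≤ k → k < t i + n → x k = x (t i) := fun k hk hk' => by
      have := hconst (k - t i + 1).toNat (by omega) (by omega)
      rwa [show t i - 1 + ((k - t i + 1).toNat : ℤ) = k by omega] at this
    refine ⟨n, hn, ?_, hconst'⟩
    have hB : t i + n ∈ Set.range t := by
      rw [hrange]
      change x (t i + n - 1) ≠ x (t i + n)
      rw [hconst' (t i + n - 1) (by omega) (by omega)]
      push_cast at hend
      rw [show t i - 1 + ((n : ℤ) + 1) = t i + n by ring] at hend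
      exact hend.symm
    obtain ⟨j, hj⟩ := hB
    have hij : i < j := ht.lt_iff_lt.1 (by omega)
    have hle : t (i + 1) ≤ t j := ht.monotone (by omega)
    have hlt := ht (lt_add_one i)
    refine le_antisymm (by omega) ?_
    by_contra! hlt'
    exact hmem (i + 1) 
      ((hconst' (t (i + 1) - 1) (by omega) (by omega)).trans
        (hconst' (t (i + 1)) (by omega) (by omega)).symm)
  choose n hn hnt hconst using hblock
  refine ⟨fun i => x (t i), t, ht, fun i => ?_, fun i => ?_, fun i k hk hk' => ?_,
    ht.exists_int_mem_Ico⟩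
  · rw [hnt]
    simpa using hn i
  · have h := (hrun (t (i + 1) - 1) (by simpa using hmem (i + 1))).1
    have hlt := ht (lt_add_one i)
    have := hnt i
    rwa [sub_add_cancel, hconst i _ (by omega) (by omega)] at h
  · exact hconst i k hk (by rwa [← hnt])

/-- With bounded block lengths, the concatenations form a subshift of finite type. -/
lemma isSFT_SGraphCore [Finite V] (hLoop : ∀ v, ¬ Adj v v) (hPos : ∀ v, 0 ∉ S v) {N : ℕ}
    (hN : ∀ v, ∀ n ∈ S v, n ≤ N) : IsSFT (SGraphCore Adj S) := by
  refine ⟨{w | w.length = N + 2 ∧ ¬ InLanguage (SGraphCore Adj S) w},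
    (List.finite_length_eq V (N + 2)).subset fun _ h => h.1, Set.Subset.antisymm ?_ ?_⟩
  · exact fun x hx w hw h => hw.2 ⟨x, hx, h⟩
  · intro x hx
    have hlocal : ∀ k : ℤ, ∃ y ∈ SGraphCore Adj S, ∃ l : ℤ,
        ∀ i : ℕ, i < N + 2 → x (k + i) = y (l + i) := fun k => by
      by_contra! h
      refine hx (window x k (N + 2)) ⟨by simp, ?_⟩ (appears_window _ _ _)
      rintro ⟨y, hy, hw⟩
      obtain ⟨l, hl⟩ := appears_iff_window.1 hw
      rw [length_window] at hl
      obtain ⟨i, hi, hne⟩ := h y hy l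
      exact hne (eq_of_window_eq hl.symm hi)
    refine mem_SGraphCore_of_runs hPos (N := N) (fun k => ?_) (fun k hk => ?_)
    · obtain ⟨y, hy, l, hl⟩ := hlocal k
      obtain ⟨i, hi, hiN, hne⟩ := SGraphCore.exists_ne hLoop hN hy l
      have h₀ := hl 0 (by omega)
      simp only [Nat.cast_zero, add_zero] at h₀
      exact ⟨i, hi, hiN, by rwa [hl i (by omega), h₀]⟩
    · obtain ⟨y, hy, l, hl⟩ := hlocal k
      have h₀ := hl 0 (by omega)
      have h₁ := hl 1 (by omega)
      simp only [Nat.cast_zero, add_zero, Nat.cast_one] at h₀ h₁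
      rw [h₀, h₁] at hk ⊢
      obtain ⟨hadj, n, hn, hconst, hend⟩ := SGraphCore.adj_and_exists_block hLoop hy hk
      have := hN _ _ hn
      exact ⟨hadj, n, hn, fun j hj hj' => by rw [hl j (by omega), hconst j hj hj'],
        by rwa [hl _ (by omega)]⟩

end Core

/-! ### Finite concatenations of blocks -/

section BlockPath

variable {V : Type*} {Adj : V → V → Prop} {S T : V → Set ℕ} {W : Set V}

/-- `BlockPath Adj S W u v w` says that `w` is a concatenation of blocks along a path of the graph
from `u` to `v`, where the final vertex `v` contributes no block and all other vertices lie
in `W`. -/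
inductive BlockPath (Adj : V → V → Prop) (S : V → Set ℕ) (W : Set V) : V → V → List V → Prop
  | nil (u : V) : BlockPath Adj S W u u []
  | cons {u u' v : V} {n : ℕ} {w : List V} (hu : u ∈ W) (hn : n ∈ S u) (hadj : Adj u u')
      (hw : BlockPath Adj S W u' v w) : BlockPath Adj S W u v (List.replicate n u ++ w)

lemma BlockPath.mono {W' : Set V} {u v : V} {w : List V} (h : BlockPath Adj S W u v w)
    (hW : W ⊆ W') : BlockPath Adj S W' u v w := by
  induction h with
  | nil u => exact .nil u
  | cons hu hn hadj _ ih => exact .cons (hW hu) hn hadj ih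

lemma BlockPath.append {u v v' : V} {w w' : List V} (h : BlockPath Adj S W u v w)
    (h' : BlockPath Adj S W v v' w') : BlockPath Adj S W u v' (w ++ w') := by
  induction h with
  | nil u => exact h'
  | cons hu hn hadj _ ih =>
    rw [List.append_assoc]
    exact .cons hu hn hadj (ih h')

/-- Blocks of a path are no longer than the whole path. -/
lemma BlockPath.truncate {u v : V} {w : List V} (h : BlockPath Adj S W u v w) {N : ℕ}
    (hN : w.length ≤ N) : BlockPath Adj (fun v => {n ∈ S v | n ≤ N}) W u v w := by
  induction h with
  | nil u => exact .nil u
  | cons hu hn hadj _ ih =>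
    simp only [List.length_append, List.length_replicate] at hN
    exact .cons hu ⟨hn, by omega⟩ hadj (ih (by omega))

/-- Decomposition of a path at its last visit to `z`. -/
lemma BlockPath.last_visit {u v : V} {w : List V} (h : BlockPath Adj S W u v w) (z : V) :
    BlockPath Adj S (W \ {z}) u v w ∨ ∃ w₁ n z' w₂, BlockPath Adj S W u z w₁ ∧
      BlockPath Adj S (W \ {z}) z' v w₂ ∧ w = w₁ ++ (List.replicate n z ++ w₂) := by
  induction h with
  | nil u => exact .inl (.nil u)
  | @cons u u' v n w hu hn hadj _ ih =>
    rcases ih with ih | ⟨w₁, n', z', w₂, h₁, h₂, rfl⟩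
    · by_cases huz : u = z
      · subst huz
        exact .inr ⟨[], n, u', w, .nil u, ih, rfl⟩
      · exact .inl (.cons ⟨hu, huz⟩ hn hadj ih)
    · exact .inr ⟨_, n', z', w₂, .cons hu hn hadj h₁, h₂, by simp⟩

lemma BlockPath.eq_nil_of_notMem {u v : V} {w : List V} (h : BlockPath Adj S W u v w)
    (hu : u ∉ W) : w = [] := by
  cases h with
  | nil => rfl
  | cons hu' => exact absurd hu' hu

/-- If all languages of loops have finite weight, then so do all languages of paths. -/
lemma weight_blockPath_ne_top [Finite V] {z : ENNReal} (hz : z < 1)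
    (hloop : ∀ u, weight z {w | BlockPath Adj S Set.univ u u w} ≠ ⊤) (W : Set V) (u v : V) :
    weight z {w | BlockPath Adj S W u v w} ≠ ⊤ := by
  induction W using WellFoundedLT.induction generalizing u v with
  | _ W ih =>
    by_cases hu : u ∈ W
    · have ih' := ih (W \ {u}) (Set.sdiff_singleton_ssubset.2 hu)
      have hsub : {w | BlockPath Adj S W u v w} ⊆ {w | BlockPath Adj S (W \ {u}) u v w} ∪
          Set.image2 (· ++ ·) {w | BlockPath Adj S Set.univ u u w}
            (Set.image2 (· ++ ·) (constWords u)
              (⋃ u', {w | BlockPath Adj S (W \ {u}) u' v w})) := by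
        intro w hw
        rcases BlockPath.last_visit hw u with h | ⟨w₁, n, u', w₂, h₁, h₂, rfl⟩
        · exact .inl h
        · exact .inr ⟨w₁, h₁.mono (Set.subset_univ _), _,
            ⟨_, ⟨n, rfl⟩, w₂, Set.mem_iUnion.2 ⟨u', h₂⟩, rfl⟩, rfl⟩
      refine ne_top_of_le_ne_top ?_ ((weight_mono z hsub).trans (weight_union_le z _ _))
      exact ENNReal.add_ne_top.2 ⟨ih' u v, weight_image2_append_ne_top (hloop u)
        (weight_image2_append_ne_top (weight_constWords_ne_top hz u)
          (weight_iUnion_ne_top fun u' => ih' u' v))⟩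
    · refine ne_top_of_le_ne_top ?_ (weight_mono z (M := {[]}) fun w hw =>
        BlockPath.eq_nil_of_notMem hw hu)
      simp [weight_singleton_nil]

/-- A word of the core is a concatenation of blocks, up to incomplete blocks at both ends. -/
lemma exists_blockPath_of_inLanguage {w : List V} (hw : InLanguage (SGraphCore Adj S) w) :
    ∃ p u u' v w' q, BlockPath Adj S Set.univ u u' w' ∧
      w = List.replicate p v ++ (w' ++ List.replicate q u') := by
  obtain ⟨x, ⟨a, t, ht, hS, hadj, hconst, hcover⟩, hw⟩ := hw
  obtain ⟨k, hk⟩ := appears_iff_window.1 hw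
  have hstart : ∀ n i, ∃ i' w' q, BlockPath Adj S Set.univ (a i) (a i') w' ∧
      window x (t i) n = w' ++ List.replicate q (a i') := fun n => by
    induction n using Nat.strong_induction_on with
    | _ n ih =>
      intro i
      have hlt := ht (lt_add_one i)
      rcases le_or_gt (t i + n) (t (i + 1)) with h | h
      · exact ⟨i, [], n, .nil _,
          window_eq_replicate fun j hj => hconst i _ (by omega) (by omega)⟩
      · obtain ⟨m, hm⟩ := Int.eq_ofNat_of_zero_le (sub_nonneg.2 hlt.le)
        obtain ⟨n', rfl⟩ := Nat.exists_eq_add_of_le (show m ≤ n by omega)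
        obtain ⟨i', w', q, hw', hq⟩ := ih n' (by omega) (i + 1)
        have hmS := hS i
        rw [hm, Int.toNat_natCast] at hmS
        refine ⟨i', _, q, .cons (Set.mem_univ _) hmS (hadj i) hw', ?_⟩
        rw [window_add, List.append_assoc, ← hq, show t i + m = t (i + 1) by omega,
          window_eq_replicate fun j hj => hconst i _ (by omega) (by omega)]
  obtain ⟨i, hi, hi'⟩ := hcover k
  rcases le_or_gt (k + w.length) (t (i + 1)) with h | h
  · refine ⟨w.length, a i, a i, a i, [], 0, .nil _, ?_⟩
    rw [← hk, length_window]
    simpa using window_eq_replicate fun j hj => hconst i _ (by omega) (by omega)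
  · obtain ⟨m, hm⟩ := Int.eq_ofNat_of_zero_le (sub_nonneg.2 hi'.le)
    obtain ⟨n', hn'⟩ := Nat.exists_eq_add_of_le (show m ≤ w.length by omega)
    obtain ⟨i', w', q, hw', hq⟩ := hstart n' (i + 1)
    refine ⟨m, a (i + 1), a i', a i, w', q, hw', ?_⟩
    rw [← hk, hn', window_add, ← hq, show k + m = t (i + 1) by omega,
      window_eq_replicate fun j hj => hconst i _ (by omega) (by omega)]

lemma weight_language_ne_top [Finite V] {z : ENNReal} (hz : z < 1)
    (hloop : ∀ u, weight z {w | BlockPath Adj S Set.univ u u w} ≠ ⊤) :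
    weight z {w | InLanguage (SGraphCore Adj S) w} ≠ ⊤ := by
  have hconst : weight z (⋃ v : V, constWords v) ≠ ⊤ :=
    weight_iUnion_ne_top fun v => weight_constWords_ne_top hz v
  refine ne_top_of_le_ne_top (weight_image2_append_ne_top hconst (weight_image2_append_ne_top
    (weight_iUnion_ne_top fun u => weight_iUnion_ne_top fun u' =>
      weight_blockPath_ne_top hz hloop Set.univ u u') hconst)) (weight_mono z fun w hw => ?_)
  obtain ⟨p, u, u', v, w', q, h, rfl⟩ := exists_blockPath_of_inLanguage hw
  exact ⟨_, Set.mem_iUnion.2 ⟨v, p, rfl⟩, _,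
    ⟨w', Set.mem_iUnion.2 ⟨u, Set.mem_iUnion.2 ⟨u', h⟩⟩, _, Set.mem_iUnion.2 ⟨u', q, rfl⟩, rfl⟩,
    rfl⟩

lemma BlockPath.exists_blocks {u v : V} {w : List V} (h : BlockPath Adj S W u v w) :
    ∃ (r : ℕ) (a : ℕ → V) (n : ℕ → ℕ), a 0 = u ∧ a r = v ∧
      (∀ i < r, n i ∈ S (a i) ∧ Adj (a i) (a (i + 1))) ∧
      w = (List.range r).flatMap fun i => List.replicate (n i) (a i) := by
  induction h with
  | nil u => exact ⟨0, fun _ => u, fun _ => 0, rfl, rfl, by simp, by simp⟩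
  | @cons u u' v n w hu hn hadj _ ih =>
    obtain ⟨r, a, m, h0, hr, hblocks, rfl⟩ := ih
    refine ⟨r + 1, fun i => Nat.casesOn i u a, fun i => Nat.casesOn i n m, rfl, hr, ?_, ?_⟩
    · rintro (_ | i) hi
      · exact ⟨hn, by simpa [h0] using hadj⟩
      · exact hblocks i (by omega)
    · simp [List.range_succ_eq_map, List.flatMap_map]

/-- Repeating a nonempty loop periodically gives a point of the core. -/
lemma BlockPath.inLanguage (hPos : ∀ v, 0 ∉ S v) {u : V} {w : List V}
    (h : BlockPath Adj S W u u w) (hw : w ≠ []) : InLanguage (SGraphCore Adj S) w := by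
  obtain ⟨r, a, n, h0, hr, hblocks, rfl⟩ := h.exists_blocks
  have hr0 : 0 < r := Nat.pos_of_ne_zero fun h => hw (by simp [h])
  have hlt : ∀ i : ℤ, (i % r).toNat < r := fun i => by
    have := Int.emod_lt_of_pos i (show (0 : ℤ) < r by omega)
    omega
  have hnext : ∀ i : ℤ, a ((i + 1) % r).toNat = a ((i % r).toNat + 1) := fun i => by
    have hnonneg := Int.emod_nonneg i (show (r : ℤ) ≠ 0 by omega)
    have hi := hlt i
    rw [← Int.emod_add_emod]
    rcases Nat.lt_or_ge ((i % r).toNat + 1) r with hlast | hlast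
    · rw [Int.emod_eq_of_lt (by omega) (by omega)]
      congr 1
      omega
    · rw [show i % r + 1 = r by omega, show (i % r).toNat + 1 = r by omega, hr, ← h0]
      simp
  obtain ⟨x, hx, t, ht, hxt⟩ := exists_mem_SGraphCore (Adj := Adj) (S := S) hPos
    (a := fun i => a (i % r).toNat) (n := fun i => n (i % r).toNat)
    (fun i => (hblocks _ (hlt i)).1) (fun i => by
      rw [hnext]
      exact (hblocks _ (hlt i)).2)
  refine ⟨x, hx, appears_iff_window.2 ⟨t 0, ?_⟩⟩
  have hwindow : ∀ s : ℕ, s ≤ r → ∃ l : ℕ, t s = t 0 + l ∧ window x (t 0) l =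
      (List.range s).flatMap fun i => List.replicate (n i) (a i) := fun s => by
    induction s with
    | zero => exact fun _ => ⟨0, by simp, rfl⟩
    | succ s ih =>
      intro hs
      obtain ⟨l, hl, hwin⟩ := ih (by omega)
      have hmod : ((s : ℤ) % r).toNat = s := by
        rw [Int.emod_eq_of_lt (by omega) (by omega)]
        simp
      have hts := ht s
      have hxs := hxt s
      simp only [hmod] at hts hxs
      refine ⟨l + n s, by push_cast; omega, ?_⟩
      rw [window_add, hwin, ← hl, List.range_succ, List.flatMap_append,
        window_eq_replicate fun j hj => hxs _ (by omega) (by omega)]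
      simp
  obtain ⟨l, -, hl⟩ := hwindow r le_rfl
  rw [← hl, length_window]

/-- The loops at `u` of length `n`. -/
def loopsOfLength (Adj : V → V → Prop) (S : V → Set ℕ) (u : V) (n : ℕ) : Set (List V) :=
  {w | BlockPath Adj S Set.univ u u w ∧ w.length = n}

lemma loopsOfLength_finite [Finite V] (u : V) (n : ℕ) : (loopsOfLength Adj S u n).Finite :=
  (List.finite_length_eq V n).subset fun _ h => h.2

lemma loopsOfLength_zero (u : V) : loopsOfLength Adj S u 0 = {[]} := by
  ext w
  simp only [loopsOfLength, Set.mem_ofPred_eq, List.length_eq_zero_iff, Set.mem_singleton_iff,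
    and_iff_right_iff_imp]
  rintro rfl
  exact .nil u

lemma ncard_loopsOfLength_mul_le [Finite V] (u : V) (m n : ℕ) :
    (loopsOfLength Adj S u m).ncard * (loopsOfLength Adj S u n).ncard ≤
      (loopsOfLength Adj S u (m + n)).ncard := by
  rw [← Set.ncard_prod]
  refine Set.ncard_le_ncard_of_injOn (fun p => p.1 ++ p.2) ?_ ?_ (loopsOfLength_finite u _)
  · rintro ⟨w, w'⟩ ⟨⟨hw, hm⟩, hw', hn⟩
    exact ⟨hw.append hw', by simp_all⟩
  · rintro ⟨w, w'⟩ ⟨⟨-, hm⟩, -⟩ ⟨v, v'⟩ ⟨⟨-, hm'⟩, -⟩ h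
    have := List.append_inj h (hm.trans hm'.symm)
    exact Prod.ext this.1 this.2

lemma ncard_loopsOfLength_pow_le [Finite V] (u : V) (m k : ℕ) :
    (loopsOfLength Adj S u m).ncard ^ k ≤ (loopsOfLength Adj S u (k * m)).ncard := by
  induction k with
  | zero => simp [loopsOfLength_zero]
  | succ k ih =>
    rw [pow_succ, add_mul, one_mul]
    exact (Nat.mul_le_mul_right _ ih).trans (ncard_loopsOfLength_mul_le u _ _)

/-- The entropy of the core bounds the exponential growth of the loops at a vertex. -/
lemma HasEntropy.log_ncard_loopsOfLength_le [Finite V] (hPos : ∀ v, 0 ∉ S v) {h : ℝ}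
    (hent : HasEntropy (SGraphCore Adj S) h) {u : V} {m : ℕ} (hm : 0 < m)
    (hne : 0 < (loopsOfLength Adj S u m).ncard) :
    Real.log (loopsOfLength Adj S u m).ncard / m ≤ h := by
  refine hent.ge_of_pow_le hm hne fun k hk => (ncard_loopsOfLength_pow_le u m k).trans ?_
  refine Set.ncard_le_ncard (fun w hw => ⟨hw.2, hw.1.inLanguage hPos ?_⟩)
    (wordsOfLength_finite _ _)
  exact List.ne_nil_of_length_pos (hw.2 ▸ Nat.mul_pos hk hm)

/-- Some language of loops grows at a rate arbitrarily close to the entropy. -/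
lemma HasEntropy.exists_loopsOfLength_ge [Finite V] {h : ℝ}
    (hent : HasEntropy (SGraphCore Adj S) h) {c : ℝ} (hc : 0 < c) (hch : c < h) :
    ∃ (u : V) (m : ℕ), 0 < m ∧ Real.exp (c * m) ≤ (loopsOfLength Adj S u m).ncard := by
  by_contra! hsmall
  have hsmall' : ∀ (u : V) (m : ℕ), ((loopsOfLength Adj S u m).ncard : ℝ) ≤
      Real.exp (c * m) := fun u m => by
    rcases Nat.eq_zero_or_pos m with rfl | hm
    · simp [loopsOfLength_zero]
    · exact (hsmall u m hm).le
  obtain ⟨b, hcb, hbh⟩ := exists_between hch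
  obtain ⟨d, hbd, hdh⟩ := exists_between hbh
  have hz : ENNReal.ofReal (Real.exp (-b)) < 1 := by
    rw [ENNReal.ofReal_lt_one, Real.exp_lt_one_iff]
    linarith
  have hencard : ∀ L : Set (List V), L.Finite → (L.encard : ENNReal) = ENNReal.ofReal L.ncard :=
    fun L hL => by
      rw [← hL.cast_ncard_eq]
      simp
  have hterm : ∀ (q : ℝ) (n : ℕ), ENNReal.ofReal q * ENNReal.ofReal (Real.exp (-b)) ^ n =
      ENNReal.ofReal (q * Real.exp (-b * n)) := fun q n => by
    rw [← ENNReal.ofReal_pow (Real.exp_pos _).le, ← Real.exp_nat_mul,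
      ← ENNReal.ofReal_mul' (Real.exp_pos _).le, mul_comm (n : ℝ)]
  have hloop : ∀ u, weight (ENNReal.ofReal (Real.exp (-b)))
      {w | BlockPath Adj S Set.univ u u w} ≠ ⊤ := fun u => by
    have hr : ENNReal.ofReal (Real.exp (c - b)) < 1 := by
      rw [ENNReal.ofReal_lt_one, Real.exp_lt_one_iff]
      linarith
    refine ne_top_of_le_ne_top ?_ ((weight_le_tsum _ _).trans
      (ENNReal.tsum_le_tsum (g := fun n => ENNReal.ofReal (Real.exp (c - b)) ^ n) fun n => ?_))
    · rw [ENNReal.tsum_geometric]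
      exact ENNReal.inv_ne_top.2 (tsub_pos_of_lt hr).ne'
    · change ((loopsOfLength Adj S u n).encard : ENNReal) * _ ≤ _
      rw [hencard _ (loopsOfLength_finite u n), hterm, ← ENNReal.ofReal_pow (Real.exp_pos _).le,
        ← Real.exp_nat_mul]
      refine ENNReal.ofReal_le_ofReal ((mul_le_mul_of_nonneg_right (hsmall' u n)
        (Real.exp_pos _).le).trans_eq ?_)
      rw [← Real.exp_add]
      ring_nf
  have hfin := weight_language_ne_top hz hloop
  have hbound : ∀ n, ((wordsOfLength (SGraphCore Adj S) n).ncard : ℝ) * Real.exp (-b * n) ≤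
      (weight (ENNReal.ofReal (Real.exp (-b)))
        {w | InLanguage (SGraphCore Adj S) w}).toReal := fun n => by
    rw [← ENNReal.ofReal_le_iff_le_toReal hfin, ← hterm, ← hencard _ (wordsOfLength_finite _ n),
      ← weight_eq_of_length fun w hw => hw.1]
    exact weight_mono _ fun w hw => hw.2
  have hgrow : Tendsto (fun n : ℕ => Real.exp ((d - b) * n)) atTop atTop :=
    Real.tendsto_exp_atTop.comp
      (tendsto_natCast_atTop_atTop.const_mul_atTop (sub_pos.2 hbd))
  obtain ⟨n, hlog, hlarge, hn⟩ := ((hent.eventually (lt_mem_nhds hdh)).and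
    ((hgrow.eventually_gt_atTop _).and (eventually_gt_atTop 0))).exists
  refine (hlarge.trans_le ?_).not_ge (hbound n)
  rw [lt_div_iff₀ (by positivity)] at hlog
  have hpos : (0 : ℝ) < (wordsOfLength (SGraphCore Adj S) n).ncard := by
    rcases Nat.eq_zero_or_pos (wordsOfLength (SGraphCore Adj S) n).ncard with h0 | h0
    · have : 0 < d * n := mul_pos (hc.trans (hcb.trans hbd)) (by positivity)
      change d * n < Real.log ((wordsOfLength (SGraphCore Adj S) n).ncard) at hlog
      simp only [h0, Nat.cast_zero, Real.log_zero] at hlog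
      linarith
    · exact_mod_cast h0
  have hexp := ((Real.lt_log_iff_exp_lt hpos).1 hlog).le
  calc Real.exp ((d - b) * n) = Real.exp (d * n) * Real.exp (-b * n) := by
        rw [← Real.exp_add]
        ring_nf
    _ ≤ _ := mul_le_mul_of_nonneg_right hexp (Real.exp_pos _).le

end BlockPath

/-- **Every S-graph shift is almost sofic:** for every `ε > 0` there is a
subshift of finite type `Y ⊆ X(G,S)` with `h(Y) ≥ h(X(G,S)) − ε`. -/
theorem SGraphShift_almost_sofic {V : Type*} [Fintype V]
    [TopologicalSpace V] [DiscreteTopology V]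
    (Adj : V → V → Prop) (S : V → Set ℕ)
    (hLoop : ∀ v, ¬ Adj v v)
    (hNe : ∀ v, (S v).Nonempty) (hPos : ∀ v, 0 ∉ S v)
    (hX : ℝ) (hent : HasEntropy (closure (SGraphCore Adj S)) hX)
    (ε : ℝ) (hε : 0 < ε) :
    ∃ Y : Set (ℤ → V), Y ⊆ closure (SGraphCore Adj S) ∧ IsSFT Y ∧
      ∃ hY : ℝ, HasEntropy Y hY ∧ hX - ε ≤ hY := by
  have := Finite.of_fintype V
  rcases le_or_gt hX ε with hle | hlt
  · refine ⟨∅, Set.empty_subset _, ⟨{[]}, Set.finite_singleton _, ?_⟩, 0, ?_, by linarith⟩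
    · ext x
      simp [Appears]
    · simp [HasEntropy, InLanguage]
  · have hcore : HasEntropy (SGraphCore Adj S) hX := by
      simpa only [HasEntropy, inLanguage_closure_iff] using hent
    obtain ⟨u, m, hm, hcard⟩ := hcore.exists_loopsOfLength_ge (sub_pos.2 hlt) (sub_lt_self hX hε)
    let T : V → Set ℕ := fun v => {n ∈ S v | n ≤ m}
    have hTPos : ∀ v, 0 ∉ T v := fun v h => hPos v h.1
    obtain ⟨hY, hYent⟩ := exists_hasEntropy (SGraphCore Adj T)
    refine ⟨SGraphCore Adj T, (SGraphCore_mono fun v n hn => hn.1).trans subset_closure,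
      isSFT_SGraphCore hLoop hTPos fun v n hn => hn.2, hY, hYent, ?_⟩
    have hcardT : Real.exp ((hX - ε) * m) ≤ (loopsOfLength Adj T u m).ncard :=
      hcard.trans (Nat.cast_le.2 (Set.ncard_le_ncard
        (fun w hw => ⟨hw.1.truncate hw.2.le, hw.2⟩) (loopsOfLength_finite u m)))
    have hpos : (0 : ℝ) < (loopsOfLength Adj T u m).ncard := (Real.exp_pos _).trans_le hcardT
    refine le_trans ?_ (hYent.log_ncard_loopsOfLength_le hTPos (u := u) hm (by exact_mod_cast hpos))
    rw [le_div_iff₀ (by positivity)]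
    exact (Real.le_log_iff_exp_le hpos).2 hcardT
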